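/- Contact interfaces: assume the Rankine–Hugoniot relation holds, π_I > 0, π_II > 0, and that the fluid in phase I has the same rapidity as the interface, W_I = Z. Then W_II = Z and p_II = p_I; that is, the interface is a contact interface across which the pressure is continuous, while the parallel velocity may jump arbitrarily. -/

import Mathlib

open Real

/-- Squared Euclidean norm of a vector. -/
noncomputable def nsq {n : ℕ} (w : Fin n → ℝ) : ℝ := ∑ j, (w j) ^ 2

/-- Minkowski bilinear form on `ℝ^{d+1}`: `η(x,y) = -x₀y₀ + ∑_{j=1}^d xⱼyⱼ`. -/
noncomputable def eta {d : ℕ} (x y : Fin (d + 1) → ℝ) : ℝ :=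
  -(x 0 * y 0) + ∑ j : Fin d, x j.succ * y j.succ

/-- Unit spacelike normal `V = (sinh Z, cosh Z, 0, …, 0)` to the interface. -/
noncomputable def normalV (d : ℕ) (Z : ℝ) : Fin (d + 1) → ℝ := fun i =>
  if i.val = 0 then Real.sinh Z else if i.val = 1 then Real.cosh Z else 0

/-- Unit timelike fluid velocity determined by the perpendicular rapidity `W` and
the parallel velocity `w ∈ ℝ^{d-1}`. -/
noncomputable def vel (d : ℕ) (W : ℝ) (w : Fin (d - 1) → ℝ) : Fin (d + 1) → ℝ := fun i =>
  if i.val = 0 then Real.sqrt (1 + nsq w) * Real.cosh W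
  else if i.val = 1 then Real.sqrt (1 + nsq w) * Real.sinh W
  else if h : i.val - 2 < d - 1 then w ⟨i.val - 2, h⟩ else 0

/-- The Rankine–Hugoniot relation
`(μ_II + p_II) η(u_II,V) u_II − (μ_I + p_I) η(u_I,V) u_I + (p_II − p_I) V = 0`. -/
def RH (d : ℕ) (μI pI μII pII : ℝ) (uI uII V : Fin (d + 1) → ℝ) : Prop :=
  ∀ i, (μII + pII) * eta uII V * uII i - (μI + pI) * eta uI V * uI i + (pII - pI) * V i = 0

theorem eta_vel_normalV {d : ℕ} (hd : 1 ≤ d) (W Z : ℝ) (w : Fin (d - 1) → ℝ) :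
    eta (vel d W w) (normalV d Z) = Real.sqrt (1 + nsq w) * Real.sinh (W - Z) := by
  obtain ⟨n, rfl⟩ : ∃ n, d = n + 1 := ⟨d - 1, by omega⟩
  rw [Real.sinh_sub, eta, Fin.sum_univ_succ]
  simp [vel, normalV]
  ring

/-- Contact interfaces: if the fluid in phase I has the same rapidity as the interface,
then so does phase II and the pressure is continuous. -/
theorem contact_interface (d : ℕ) (hd : 2 ≤ d) (Z μI μII pI pII WI WII : ℝ)
    (wI wII : Fin (d - 1) → ℝ) (hμI : 0 ≤ μI) (hμII : 0 ≤ μII)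
    (hπI : 0 < (μI + pI) * (1 + nsq wI)) (hπII : 0 < (μII + pII) * (1 + nsq wII))
    (hW : WI = Z)
    (hRH : RH d μI pI μII pII (vel d WI wI) (vel d WII wII) (normalV d Z)) :
    WII = Z ∧ pII = pI := by
  subst hW
  have hnsq : 0 ≤ nsq wII := Finset.sum_nonneg fun j _ => sq_nonneg (wII j)
  have hs : Real.sqrt (1 + nsq wII) ^ 2 = 1 + nsq wII := Real.sq_sqrt (by linarith)
  have hzero := hRH ⟨0, by omega⟩
  have hone := hRH ⟨1, by omega⟩
  rw [eta_vel_normalV (by omega), eta_vel_normalV (by omega)] at hzero hone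
  simp only [sub_self, Real.sinh_zero, mul_zero, zero_mul, sub_zero, vel, normalV, if_true,
    one_ne_zero, if_false] at hzero hone
  have hprod : (μII + pII) * (1 + nsq wII) * Real.cosh (WII - WI) * Real.sinh (WII - WI) = 0 := by
    rw [← hs, Real.cosh_sub]
    linear_combination Real.cosh WI * hzero - Real.sinh WI * hone
  have hsinh : Real.sinh (WII - WI) = 0 :=
    (mul_eq_zero.mp hprod).resolve_left (mul_pos hπII (Real.cosh_pos _)).ne'
  refine ⟨sub_eq_zero.mp (Real.sinh_eq_zero.mp hsinh), ?_⟩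
  rw [hsinh] at hone
  have hP : (pII - pI) * Real.cosh WI = 0 := by linear_combination hone
  exact sub_eq_zero.mp ((mul_eq_zero.mp hP).resolve_right (Real.cosh_pos _).ne')
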